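/- For any ϱ ≥ 0 and α > 0, the function ρ(x) := (1/c(α)) · (1/(2α√π)) · x^{-1/2} erf((α/2)√((λ_+ - x)(x - λ_-)/x)) on [λ_-, λ_+], extended by zero outside, is a probability density, i.e., ∫_{λ_-}^{λ_+} ρ(x) dx = 1. -/

import Mathlib

open Real

/-- Modified Bessel function of the first kind `I_ν`, defined by its power series. -/
noncomputable def besselI (ν x : ℝ) : ℝ :=
  ∑' k : ℕ, (x / 2) ^ (2 * (k : ℝ) + ν) / ((Nat.factorial k : ℝ) * Real.Gamma (ν + k + 1))

/-- The coefficient `c(α) = e^{-α²/2} (I₀(α²/2) + I₁(α²/2))`. -/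
noncomputable def cWeak (α : ℝ) : ℝ :=
  Real.exp (-α ^ 2 / 2) * (besselI 0 (α ^ 2 / 2) + besselI 1 (α ^ 2 / 2))

/-- The error function `erf(x) = (2/√π) ∫₀ˣ e^{-t²} dt`. -/
noncomputable def erf (x : ℝ) : ℝ :=
  2 / Real.sqrt Real.pi * ∫ t in (0 : ℝ)..x, Real.exp (-t ^ 2)

/-- The limiting real eigenvalue density at weak non-Hermiticity (on `[λ₋, λ₊]`). -/
noncomputable def rhoWeak (ϱ α x : ℝ) : ℝ :=
  1 / cWeak α * (1 / (2 * α * Real.sqrt Real.pi)) * x ^ (-(1 / 2 : ℝ)) *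
    erf (α / 2 * Real.sqrt
      (((Real.sqrt (ϱ + 1) + 1) ^ 2 - x) * (x - (Real.sqrt (ϱ + 1) - 1) ^ 2) / x))

lemma rw_cosInt_succ (n : ℕ) : ∫ x in (0:ℝ)..π, cos x ^ (n+2) = (n+1)/(n+2) * ∫ x in (0:ℝ)..π, cos x ^ n := by
  rw [integral_cos_pow]; simp

lemma rw_cosInt_even (k : ℕ) : ∫ x in (0:ℝ)..π, cos x ^ (2*k) =
    π * (Nat.factorial (2*k)) / (4^k * (Nat.factorial k : ℝ)^2) := by
  induction k with
  | zero => simp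
  | succ k ih =>
    rw [show 2*(k+1) = 2*k+2 by ring, rw_cosInt_succ, ih, Nat.factorial_succ (2*k+1), Nat.factorial_succ (2*k),
      Nat.factorial_succ k]
    have := Nat.factorial_ne_zero k
    push_cast
    field_simp
    ring

lemma rw_cosInt_odd (k : ℕ) : ∫ x in (0:ℝ)..π, cos x ^ (2*k+1) = 0 := by
  induction k with
  | zero => simp
  | succ k ih =>
    rw [show 2*(k+1)+1 = 2*k+1+2 by ring, rw_cosInt_succ, ih, mul_zero]

lemma rw_H (z : ℝ) (hz : 0 < z) : HasSum (fun n : ℕ => ∫ x in (0:ℝ)..π, (z * cos x)^n / (Nat.factorial n) * (1 + cos x))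
      (∫ x in (0:ℝ)..π, exp (z * cos x) * (1 + cos x)) := by
    apply intervalIntegral.hasSum_integral_of_dominated_convergence
      (fun n _ => z^n / (Nat.factorial n) * 2)
    · intro n
      exact (by fun_prop : Continuous _).aestronglyMeasurable
    · intro n
      refine Filter.Eventually.of_forall fun x _ => ?_
      rw [norm_mul, norm_div, norm_pow, norm_mul]
      simp only [Real.norm_eq_abs, Nat.abs_cast, abs_of_pos hz]
      have h1 := abs_cos_le_one x
      have h2 : |1 + cos x| ≤ 2 := by
        rw [abs_le]; constructor <;> linarith [neg_one_le_cos x, cos_le_one x]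
      have h3 : z * |cos x| ≤ z := by nlinarith
      gcongr
    · refine Filter.Eventually.of_forall fun x _ => ?_
      exact (Real.summable_pow_div_factorial z).mul_right 2
    · simp
    · refine Filter.Eventually.of_forall fun x _ => ?_
      refine HasSum.mul_right _ ?_
      rw [Real.exp_eq_exp_ℝ]
      exact NormedSpace.expSeries_div_hasSum_exp (z * cos x)

lemma rw_A (z : ℝ) : ∀ n : ℕ, ∫ x in (0:ℝ)..π, (z * cos x)^n / (Nat.factorial n) * (1 + cos x) =
      z^n / Nat.factorial n * ((∫ x in (0:ℝ)..π, cos x ^ n) + ∫ x in (0:ℝ)..π, cos x ^ (n+1)) := by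
    intro n
    rw [← intervalIntegral.integral_add (Continuous.intervalIntegrable (by fun_prop) _ _)
      (Continuous.intervalIntegrable (by fun_prop) _ _), ← intervalIntegral.integral_const_mul]
    congr 1; ext x; rw [mul_pow]; ring

lemma rw_T0 (z : ℝ) (k : ℕ) :
    ∫ x in (0:ℝ)..π, (z * cos x)^(2*k) / (Nat.factorial (2*k)) * (1 + cos x) =
    π * ((z / 2) ^ (2 * (k : ℝ) + 0) / ((Nat.factorial k : ℝ) * Real.Gamma (0 + k + 1))) := by
  rw [rw_A, rw_cosInt_odd, rw_cosInt_even, show (2 * (k:ℝ) + 0) = ((2*k : ℕ) : ℝ) by push_cast; ring,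
    rpow_natCast, show (0 + (k:ℝ) + 1) = k + 1 by ring, Real.Gamma_nat_eq_factorial, div_pow,
    pow_mul 2 2 k]
  have := Nat.factorial_ne_zero k
  have := Nat.factorial_ne_zero (2*k)
  norm_num
  field_simp

lemma rw_T1 (z : ℝ) (k : ℕ) :
    ∫ x in (0:ℝ)..π, (z * cos x)^(2*k+1) / (Nat.factorial (2*k+1)) * (1 + cos x) =
    π * ((z / 2) ^ (2 * (k : ℝ) + 1) / ((Nat.factorial k : ℝ) * Real.Gamma (1 + k + 1))) := by
  rw [rw_A, rw_cosInt_odd, show 2*k+1+1 = 2*(k+1) by ring, rw_cosInt_even,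
    show (2 * (k:ℝ) + 1) = ((2*k+1 : ℕ) : ℝ) by push_cast; ring,
    rpow_natCast, show (1 + (k:ℝ) + 1) = ((k+1:ℕ):ℝ) + 1 by push_cast; ring, Real.Gamma_nat_eq_factorial, div_pow,
    pow_succ 2 (2*k), pow_mul 2 2 k, show 2*(k+1) = 2*k+1+1 by ring, Nat.factorial_succ (2*k+1), Nat.factorial_succ k]
  have := Nat.factorial_ne_zero k
  have := Nat.factorial_ne_zero (2*k+1)
  push_cast
  norm_num
  field_simp
  ring

lemma rw_split (a b c : ℕ → ℝ) (S : ℝ) (h : HasSum a S) (hb : ∀ k, a (2*k) = b k)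
    (hc : ∀ k, a (2*k+1) = c k) : S = ∑' k, b k + ∑' k, c k := by
  have hs := h.summable
  have h1 : Summable fun k : ℕ => a (2*k) :=
    hs.comp_injective (i := fun k : ℕ => 2*k) (fun x y h => by simpa using h)
  have h2 : Summable fun k : ℕ => a (2*k+1) :=
    hs.comp_injective (i := fun k : ℕ => 2*k+1) (fun x y h => by simpa using h)
  rw [← h.tsum_eq, ← tsum_even_add_odd h1 h2, tsum_congr hb, tsum_congr hc]

lemma rw_bessel (z : ℝ) (hz : 0 < z) : ∫ x in (0:ℝ)..π, exp (z * cos x) * (1 + cos x) =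
    π * (besselI 0 z + besselI 1 z) := by
  rw [rw_split _ _ _ _ (rw_H z hz) (rw_T0 z) (rw_T1 z), tsum_mul_left, tsum_mul_left, ← mul_add]
  unfold besselI
  rfl

lemma rw_c (α : ℝ) (hα : 0 < α) : π * cWeak α =
    exp (-α^2/2) * ∫ x in (0:ℝ)..π, exp (α^2/2 * cos x) * (1 + cos x) := by
  rw [rw_bessel _ (by positivity), cWeak]; ring

lemma rw_c_pos (α : ℝ) (hα : 0 < α) : 0 < cWeak α := by
  have h : 0 < π * cWeak α := by
    rw [rw_c α hα]
    refine mul_pos (exp_pos _) ?_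
    refine intervalIntegral.intervalIntegral_pos_of_pos_on (Continuous.intervalIntegrable (by fun_prop) _ _) ?_ pi_pos
    intro x hx
    have : -1 < cos x := by
      rw [← cos_pi]; exact cos_lt_cos_of_nonneg_of_le_pi hx.1.le le_rfl hx.2
    exact mul_pos (exp_pos _) (by linarith)
  exact pos_of_mul_pos_right h pi_pos.le

lemma rw_erf_deriv (x : ℝ) : HasDerivAt erf (2 / √π * exp (-x^2)) x := by
  unfold erf
  refine HasDerivAt.const_mul _ ?_
  exact (by fun_prop : Continuous fun t : ℝ => exp (-t^2)).integral_hasStrictDerivAt 0 x |>.hasDerivAt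

lemma rw_erf_cont : Continuous erf :=
  continuous_iff_continuousAt.2 fun x => (rw_erf_deriv x).continuousAt

lemma rw_J (α : ℝ) (hα : 0 < α) : ∫ u in (0:ℝ)..2, erf (α/2 * √(4 - u^2)) = α * √π * cWeak α := by
  have hc := rw_erf_cont
  have h1 := intervalIntegral.integral_comp_mul_deriv (a := π/2) (b := 0) (f := fun θ => 2 * cos θ)
    (f' := fun θ => 2 * (-sin θ)) (g := fun u => erf (α/2 * √(4 - u^2)))
    (fun x _ => (hasDerivAt_cos x).const_mul 2) (by fun_prop) (by fun_prop)
  simp only [cos_pi_div_two, cos_zero, mul_zero, mul_one] at h1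
  rw [← h1, intervalIntegral.integral_symm]
  have h2 : ∀ θ ∈ Set.uIcc 0 (π/2), ((fun u => erf (α/2 * √(4 - u^2))) ∘ fun θ => 2 * cos θ) θ * (2 * -sin θ)
      = 2 * (erf (α * sin θ) * (-sin θ)) := by
    intro θ hθ
    rw [Set.uIcc_of_le (by positivity)] at hθ
    have hs := sin_nonneg_of_nonneg_of_le_pi hθ.1 (by linarith [hθ.2, pi_pos])
    simp only [Function.comp]
    rw [show 4 - (2 * cos θ)^2 = (2 * sin θ)^2 by nlinarith [sin_sq_add_cos_sq θ], sqrt_sq (by positivity)]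
    rw [show α/2 * (2 * sin θ) = α * sin θ by ring]; ring
  rw [intervalIntegral.integral_congr h2, intervalIntegral.integral_const_mul]
  have hd : ∀ x, HasDerivAt (fun θ => erf (α * sin θ)) (2 / √π * exp (-(α * sin x)^2) * (α * cos x)) x := fun x =>
    HasDerivAt.comp (h₂ := erf) (h := fun y => α * sin y) x (rw_erf_deriv (α * sin x)) ((hasDerivAt_sin x).const_mul α)
  rw [intervalIntegral.integral_mul_deriv_eq_deriv_mul (fun x _ => hd x) (fun x _ => hasDerivAt_cos x)
    (Continuous.intervalIntegrable (by fun_prop) _ _) (Continuous.intervalIntegrable (by fun_prop) _ _)]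
  have h0 : erf 0 = 0 := by simp [erf]
  simp only [cos_pi_div_two, sin_zero, mul_zero, h0, zero_mul, sub_zero, zero_sub]
  have h3 : ∀ x, 2 / √π * exp (-(α * sin x)^2) * (α * cos x) * cos x =
      (α / √π * exp (-α^2/2)) * (exp (α^2/2 * cos (2 * x)) * (1 + cos (2*x))) := by
    intro x
    have e1 : exp (-(α * sin x)^2) = exp (-α^2/2) * exp (α^2/2 * cos (2 * x)) := by
      rw [← exp_add]; congr 1; rw [cos_two_mul, mul_pow, sin_sq]; ring
    rw [e1]
    rw [cos_two_mul x]; ring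
  simp only [h3]
  rw [intervalIntegral.integral_const_mul,
    intervalIntegral.integral_comp_mul_left (fun y => exp (α^2/2 * cos y) * (1 + cos y)) (two_ne_zero),
    mul_zero, mul_div_cancel₀ _ (two_ne_zero)]
  have h4 := rw_c α hα
  set K := ∫ x in (0:ℝ)..π, exp (α^2/2 * cos x) * (1 + cos x)
  have h5 : α / √π * exp (-α^2/2) * K = α * √π * cWeak α := by
    rw [mul_assoc, ← h4]
    have : √π * √π = π := mul_self_sqrt pi_pos.le
    have hp : √π ≠ 0 := by positivity
    field_simp
    rw [sq, this]
  rw [← h5, smul_eq_mul]; ring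

lemma rw_schlo (f : ℝ → ℝ) (hf : Continuous f) (he : ∀ x, f (-x) = f x) (s : ℝ) (hs : 1 ≤ s) :
    ∫ y in (s-1)..(s+1), f (y - (s^2-1)/y) = ∫ u in (0:ℝ)..2, f u := by
  rcases hs.eq_or_lt with rfl | hs
  · norm_num
  set r := s^2-1 with hr
  have hrp : 0 < r := by nlinarith
  have hm : r / (s-1) = s+1 := by rw [hr]; have : s - 1 ≠ 0 := by linarith
                                  field_simp; ring
  have hm' : r / (s+1) = s-1 := by rw [hr]; have : s + 1 ≠ 0 := by linarith
                                   field_simp; ring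
  have hne : ∀ y ∈ Set.uIcc (s-1) (s+1), y ≠ 0 := by
    intro y hy
    rw [Set.uIcc_of_le (by linarith)] at hy
    linarith [hy.1]
  have hc : ContinuousOn (fun y => y - r/y) (Set.uIcc (s-1) (s+1)) :=
    continuousOn_id.sub (continuousOn_const.div continuousOn_id hne)
  have hi1 : ContinuousOn (fun y => f (y - r/y)) (Set.uIcc (s-1) (s+1)) := hf.comp_continuousOn hc
  have hd2 : ContinuousOn (fun y:ℝ => r/y^2) (Set.uIcc (s-1) (s+1)) :=
    continuousOn_const.div (by fun_prop) (fun y hy => pow_ne_zero 2 (hne y hy))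
  have e1 := intervalIntegral.integral_comp_mul_deriv (a := s-1) (b := s+1) (f := fun y => y - r/y)
    (f' := fun y => 1 + r/y^2) (g := f) (fun y hy => by
      have := (hasDerivAt_id y).sub ((hasDerivAt_inv (hne y hy)).const_mul r)
      simp only [div_eq_mul_inv]
      convert! this using 1
      field_simp
      try ring) (by fun_prop) hf
  have e2 := intervalIntegral.integral_comp_mul_deriv' (a := s-1) (b := s+1) (f := fun y => r/y)
    (f' := fun y => -(r/y^2)) (g := fun w => f (w - r/w)) (fun y hy => by
      have := ((hasDerivAt_inv (hne y hy)).const_mul r)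
      simp only [div_eq_mul_inv]
      convert! this using 1
      field_simp) (by fun_prop) (by
        refine hi1.mono ?_
        rintro _ ⟨y, hy, rfl⟩
        rw [Set.uIcc_of_le (by linarith)] at hy ⊢
        have hy0 : 0 < y := by linarith [hy.1]
        constructor
        · show _ ≤ r / y
          rw [le_div_iff₀ hy0]; nlinarith [hy.2]
        · show r / y ≤ _
          rw [div_le_iff₀ hy0]; nlinarith [hy.1])
  simp only [Function.comp, hm, hm'] at e1 e2
  have e3 : ∫ y in (s-1)..(s+1), f (r/y - r/(r/y)) * -(r/y^2) = -∫ y in (s-1)..(s+1), f (y - r/y) * (r/y^2) := by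
    rw [← intervalIntegral.integral_neg]
    refine intervalIntegral.integral_congr fun y hy => ?_
    have hy0 := hne y hy
    rw [show r/(r/y) = y by field_simp, ← he]
    rw [show -(r/y - y) = y - r/y by ring]; ring
  rw [e3, intervalIntegral.integral_symm (s-1) (s+1), neg_inj] at e2
  have e4 : ∫ y in (s-1)..(s+1), f (y - r/y) * (1 + r/y^2) =
      (∫ y in (s-1)..(s+1), f (y - r/y)) + ∫ y in (s-1)..(s+1), f (y - r/y) * (r/y^2) := by
    rw [← intervalIntegral.integral_add hi1.intervalIntegrable (ContinuousOn.intervalIntegrable (u := fun y => f (y - r/y) * (r/y^2)) (hi1.mul hd2))]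
    congr 1; ext y; ring
  have e5 : ∫ u in (-2:ℝ)..2, f u = 2 * ∫ u in (0:ℝ)..2, f u := by
    rw [← intervalIntegral.integral_add_adjacent_intervals (b := 0) (hf.intervalIntegrable _ _) (hf.intervalIntegrable _ _)]
    have := intervalIntegral.integral_comp_neg (a := 0) (b := 2) f
    simp only [he, neg_zero] at this
    rw [← this]; ring
  rw [e4, e2, show s - 1 - (s+1) = -2 by ring, show s + 1 - (s-1) = 2 by ring, e5] at e1
  linarith

/-- `ρ_{α,ϱ}^w` integrates to one over `[λ₋, λ₊]`. -/
theorem rhoWeak_integral_eq_one (ϱ α : ℝ) (hϱ : 0 ≤ ϱ) (hα : 0 < α) :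
    ∫ x in ((Real.sqrt (ϱ + 1) - 1) ^ 2)..((Real.sqrt (ϱ + 1) + 1) ^ 2),
      rhoWeak ϱ α x = 1 := by
  set s := √(ϱ + 1) with hs
  have hs1 : 1 ≤ s := by rw [hs]; exact one_le_sqrt.2 (by linarith)
  have himg : (fun y : ℝ => y^2) '' Set.Ioo (s-1) (s+1) = Set.Ioo ((s-1)^2) ((s+1)^2) := by
    ext x
    constructor
    · rintro ⟨y, hy, rfl⟩
      have h1 := hy.1
      have h2 := hy.2
      constructor <;> simp only <;> nlinarith
    · intro hx
      have hx0 : 0 ≤ x := (sq_nonneg _).trans hx.1.le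
      refine ⟨√x, ⟨?_, ?_⟩, sq_sqrt hx0⟩
      · exact lt_sqrt_of_sq_lt hx.1
      · exact (sqrt_lt' (by linarith)).2 hx.2
  have hJ := rw_schlo (fun u => erf (α/2 * √(4 - u^2)))
    (by have := rw_erf_cont; fun_prop) (by intro x; simp) s hs1
  rw [rw_J α hα] at hJ
  rw [intervalIntegral.integral_of_le (by nlinarith), MeasureTheory.integral_Ioc_eq_integral_Ioo, ← himg,
    MeasureTheory.integral_image_eq_integral_abs_deriv_smul (f' := fun y => 2 * y) measurableSet_Ioo
      (fun y _ => by simpa using (hasDerivAt_pow 2 y).hasDerivWithinAt)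
      (fun a ha b hb h => by
        have h1 : 0 ≤ a := by linarith [ha.1]
        have h2 : 0 ≤ b := by linarith [hb.1]
        exact (pow_left_inj₀ h1 h2 two_ne_zero).1 h)]
  have hcong : ∀ y ∈ Set.Ioo (s-1) (s+1), |2 * y| • rhoWeak ϱ α (y^2) =
      (1 / cWeak α * (1 / (α * √π))) * erf (α/2 * √(4 - (y - (s^2-1)/y)^2)) := by
    intro y hy
    have hy0 : 0 < y := by linarith [hy.1]
    rw [rhoWeak, ← hs, abs_of_pos (by positivity), smul_eq_mul]
    have e1 : (y^2) ^ (-(1/2:ℝ)) = y⁻¹ := by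
      rw [rpow_neg (by positivity), ← sqrt_eq_rpow, sqrt_sq hy0.le]
    have e2 : ((s+1)^2 - y^2) * (y^2 - (s-1)^2) / y^2 = 4 - (y - (s^2-1)/y)^2 := by
      field_simp; ring
    rw [e1, e2]
    field_simp
  rw [MeasureTheory.setIntegral_congr_fun measurableSet_Ioo hcong, MeasureTheory.integral_const_mul,
    ← MeasureTheory.integral_Ioc_eq_integral_Ioo, ← intervalIntegral.integral_of_le (by linarith), hJ]
  have := (rw_c_pos α hα).ne'
  have : √π ≠ 0 := by positivity
  field_simp
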